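/- Permutations of length n+1 avoiding the pattern 3-12-3 are in bijection with bicolored set partitions of {1,...,n} (set partitions in which each block is assigned one of two colors). Moreover, under this bijection, the number of blocks of the first color equals the number of left-to-right maxima of the permutation minus 1, and the number of blocks of the second color equals the number of right-to-left maxima minus 1. -/

import Mathlib

/-- `l` is a permutation of `{1, …, n}`. -/
def IsPermOf (n : ℕ) (l : List ℕ) : Prop :=
  l.Perm ((List.range n).map (· + 1))

/-- Occurrence of the pattern `3-12-3` in `π`: indices `i < j, j+1 < l` with
`π j < π (j+1)` and both `π i` and `π l` greater than `π j, π (j+1)`. -/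
def Occ3123 (π : List ℕ) : Prop :=
  ∃ i j l, i < j ∧ j + 1 < l ∧ l < π.length ∧
    π.getD j 0 < π.getD (j + 1) 0 ∧
    π.getD (j + 1) 0 < π.getD i 0 ∧ π.getD (j + 1) 0 < π.getD l 0

/-- Number of left-to-right maxima of `l`. -/
def numLMAX (l : List ℕ) : ℕ :=
  ((Finset.range l.length).filter fun i => ∀ j < i, l.getD j 0 < l.getD i 0).card

/-- Number of right-to-left maxima of `l`. -/
def numRMAX (l : List ℕ) : ℕ :=
  ((Finset.range l.length).filter fun i =>
    ∀ j < l.length, i < j → l.getD j 0 < l.getD i 0).card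


/-- Two types with `ℕ × ℕ`-valued statistics are equivalent in a statistic preserving way. -/
def StatEq {X Y : Type} (s : X → ℕ × ℕ) (t : Y → ℕ × ℕ) : Prop :=
  ∃ e : X ≃ Y, ∀ x, t (e x) = s x

/-- One-step extension: either one of `k + m` neutral choices, or a Boolean choice. -/
abbrev ExtT {X : Type} (s : X → ℕ × ℕ) : Type :=
  Σ x : X, (Fin ((s x).1 + (s x).2) ⊕ Bool)

/-- Effect of a choice on the statistic. -/
def bump {D : Type} (k : ℕ × ℕ) : D ⊕ Bool → ℕ × ℕ
  | Sum.inl _ => k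
  | Sum.inr true => (k.1 + 1, k.2)
  | Sum.inr false => (k.1, k.2 + 1)

/-- Statistic on the extension. -/
def extS {X : Type} (s : X → ℕ × ℕ) : ExtT s → ℕ × ℕ := fun y => bump (s y.1) y.2

theorem StatEq.symm {X Y : Type} {s : X → ℕ × ℕ} {t : Y → ℕ × ℕ} (h : StatEq s t) :
    StatEq t s := by
  obtain ⟨e, he⟩ := h
  exact ⟨e.symm, fun y => by rw [← he]; simp⟩

theorem StatEq.trans {X Y Z : Type} {s : X → ℕ × ℕ} {t : Y → ℕ × ℕ} {u : Z → ℕ × ℕ}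
    (h : StatEq s t) (h' : StatEq t u) : StatEq s u := by
  obtain ⟨e, he⟩ := h
  obtain ⟨e', he'⟩ := h'
  exact ⟨e.trans e', fun y => by simp [he, he']⟩

theorem StatEq.of_ext {X X' : Type} (s : X → ℕ × ℕ) (s' : X' → ℕ × ℕ) (D : X → Type)
    (hfin : ∀ x, Finite (D x))
    (hD : ∀ x, Nat.card (D x) = (s x).1 + (s x).2) (φ : (Σ x, D x ⊕ Bool) → X')
    (hφ : Function.Bijective φ) (hs : ∀ y, s' (φ y) = bump (s y.1) y.2) :
    StatEq (extS s) s' := by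
  classical
  let ε : ∀ x, D x ≃ Fin ((s x).1 + (s x).2) := fun x =>
    Finite.equivFinOfCardEq (hD x)
  let e₁ : (Σ x, D x ⊕ Bool) ≃ ExtT s :=
    Equiv.sigmaCongrRight fun x => Equiv.sumCongr (ε x) (Equiv.refl Bool)
  refine ⟨e₁.symm.trans (Equiv.ofBijective φ hφ), fun y => ?_⟩
  obtain ⟨y, rfl⟩ := e₁.surjective y
  simp only [Equiv.trans_apply, Equiv.symm_apply_apply, Equiv.ofBijective_apply, hs]
  rcases y with ⟨x, d | b⟩
  · rfl
  · cases b <;> rfl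

theorem StatEq.ext {X Y : Type} {s : X → ℕ × ℕ} {t : Y → ℕ × ℕ} (h : StatEq s t) :
    StatEq (extS s) (extS t) := by
  obtain ⟨e, he⟩ := h
  refine StatEq.of_ext s (extS t) (fun x => Fin ((t (e x)).1 + (t (e x)).2))
    (fun x => inferInstance) (fun x => by simp [he])
    (fun y => ⟨e y.1, y.2⟩) ?_ ?_
  · exact (Equiv.sigmaCongrLeft (β := fun y => Fin ((t y).1 + (t y).2) ⊕ Bool) e).bijective
  · rintro ⟨x, d | (_ | _)⟩ <;> simp [extS, bump, he]

/-- Bicolored equivalence relations. -/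
abbrev BZ (α : Type) : Type :=
  {p : Setoid α × (α → Bool) // ∀ a b, p.1 a b → p.2 a = p.2 b}

/-- Color of a class. -/
def BZ.col {α : Type} (z : BZ α) : Quotient z.1.1 → Bool := Quotient.lift z.1.2 z.2

/-- Number of classes of each color. -/
noncomputable def BZ.stat {α : Type} (z : BZ α) : ℕ × ℕ :=
  (Nat.card {q // z.col q = true}, Nat.card {q // z.col q = false})

/-- Bicolored equivalence relation from a map to a bicolored type. -/
def mkZ {α T : Type} (f : α → T) (c : T → Bool) : BZ α :=
  ⟨(Setoid.ker f, fun a => c (f a)), fun a b h => by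
    have h' : f a = f b := h
    simp only [h']⟩

theorem mkZ_rel {α T : Type} (f : α → T) (c : T → Bool) (a b : α) :
    (mkZ f c).1.1 a b ↔ f a = f b := Iff.rfl

theorem mkZ_stat {α T : Type} (f : α → T) (c : T → Bool) (hf : Function.Surjective f) :
    (mkZ f c).stat = (Nat.card {t // c t = true}, Nat.card {t // c t = false}) := by
  let e : Quotient (Setoid.ker f) ≃ T := Setoid.quotientKerEquivOfSurjective f hf
  have he : ∀ q, c (e q) = (mkZ f c).col q := by
    intro q
    induction q using Quotient.inductionOn with
    | _ a => rfl
  have key : ∀ b, Nat.card {q // (mkZ f c).col q = b} = Nat.card {t // c t = b} := by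
    intro b
    exact Nat.card_congr (e.subtypeEquiv fun q => by rw [he q])
  exact Prod.ext (key true) (key false)

/-- Adding a new element to a bicolored equivalence relation. -/
def insZ {n : ℕ} (y : Σ z : BZ (Fin n), Quotient z.1.1 ⊕ Bool) : BZ (Fin (n + 1)) :=
  match y with
  | ⟨z, Sum.inl q⟩ => mkZ (Fin.cons q (fun a => Quotient.mk z.1.1 a) : Fin (n + 1) → Quotient z.1.1) z.col
  | ⟨z, Sum.inr b⟩ => mkZ (Fin.cons none (fun a => some (Quotient.mk z.1.1 a)) :
      Fin (n + 1) → Option (Quotient z.1.1)) (fun o => o.elim b z.col)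

theorem insZ_rel_succ {n : ℕ} (z : BZ (Fin n)) (o) (a b : Fin n) :
    (insZ ⟨z, o⟩).1.1 a.succ b.succ ↔ z.1.1 a b := by
  rcases o with q | b
  · refine (mkZ_rel _ _ _ _).trans ?_
    simp only [Fin.cons_succ]
    exact Quotient.eq
  · refine (mkZ_rel _ _ _ _).trans ?_
    simp only [Fin.cons_succ, Option.some_inj]
    exact Quotient.eq

theorem insZ_col_succ {n : ℕ} (z : BZ (Fin n)) (o) (a : Fin n) :
    (insZ ⟨z, o⟩).1.2 a.succ = z.1.2 a := by
  rcases o with q | b <;> simp [insZ, mkZ, BZ.col]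

theorem insZ_rel_zero_inl {n : ℕ} (z : BZ (Fin n)) (q) (a : Fin n) :
    (insZ ⟨z, Sum.inl q⟩).1.1 0 a.succ ↔ q = Quotient.mk z.1.1 a := by
  refine (mkZ_rel _ _ _ _).trans ?_
  simp only [Fin.cons_succ, Fin.cons_zero]

theorem insZ_rel_zero_inr {n : ℕ} (z : BZ (Fin n)) (b) (a : Fin n) :
    ¬ (insZ ⟨z, Sum.inr b⟩).1.1 0 a.succ := by
  refine fun h => ?_
  have h' := (mkZ_rel _ _ _ _).1 h
  simp at h'

theorem insZ_col_zero_inr {n : ℕ} (z : BZ (Fin n)) (b) :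
    (insZ ⟨z, Sum.inr b⟩).1.2 0 = b := by
  simp [insZ, mkZ]

theorem BZ.ext_succ {n : ℕ} (z w : BZ (Fin (n + 1)))
    (h : ∀ a b : Fin n, z.1.1 a.succ b.succ ↔ w.1.1 a.succ b.succ)
    (h0 : ∀ a : Fin n, z.1.1 0 a.succ ↔ w.1.1 0 a.succ)
    (hc : ∀ a : Fin n, z.1.2 a.succ = w.1.2 a.succ) (hc0 : z.1.2 0 = w.1.2 0) : z = w := by
  refine Subtype.ext (Prod.ext ?_ ?_)
  · ext a b
    refine Fin.cases ?_ (fun a => ?_) a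
    · refine Fin.cases ?_ (fun b => h0 b) b
      exact ⟨fun _ => w.1.1.refl _, fun _ => z.1.1.refl _⟩
    · refine Fin.cases ?_ (fun b => h a b) b
      exact ⟨fun k => w.1.1.symm ((h0 a).1 (z.1.1.symm k)),
        fun k => z.1.1.symm ((h0 a).2 (w.1.1.symm k))⟩
  · funext a
    exact Fin.cases hc0 hc a

theorem insZ_bijective (n : ℕ) : Function.Bijective (insZ (n := n)) := by
  constructor
  · rintro ⟨z, o⟩ ⟨w, u⟩ h
    have hzw : z = w := by
      refine Subtype.ext (Prod.ext ?_ ?_)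
      · ext a b
        rw [← insZ_rel_succ z o, ← insZ_rel_succ w u, h]
      · funext a
        rw [← insZ_col_succ z o, ← insZ_col_succ w u, h]
    subst hzw
    congr 1
    rcases o with q | b <;> rcases u with q' | b'
    · induction q using Quotient.inductionOn with
      | _ a =>
        have h1 := (insZ_rel_zero_inl z (Quotient.mk _ a) a).2 rfl
        rw [h, insZ_rel_zero_inl] at h1
        rw [h1]
    · induction q using Quotient.inductionOn with
      | _ a =>
        have h1 := (insZ_rel_zero_inl z (Quotient.mk _ a) a).2 rfl
        rw [h] at h1
        exact absurd h1 (insZ_rel_zero_inr z b' a)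
    · induction q' using Quotient.inductionOn with
      | _ a =>
        have h1 := (insZ_rel_zero_inl z (Quotient.mk _ a) a).2 rfl
        rw [← h] at h1
        exact absurd h1 (insZ_rel_zero_inr z b a)
    · rw [← insZ_col_zero_inr z b, h, insZ_col_zero_inr]
  · intro w
    let z : BZ (Fin n) := ⟨(Setoid.comap Fin.succ w.1.1, fun a => w.1.2 a.succ),
      fun a b h => w.2 _ _ h⟩
    by_cases hex : ∃ a : Fin n, w.1.1 0 a.succ
    · obtain ⟨a, ha⟩ := hex
      refine ⟨⟨z, Sum.inl (Quotient.mk _ a)⟩, ?_⟩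
      apply BZ.ext_succ
      · intro x y
        rw [insZ_rel_succ]
        rfl
      · intro x
        rw [insZ_rel_zero_inl, Quotient.eq]
        exact ⟨fun k => w.1.1.trans ha k, fun k => w.1.1.trans (w.1.1.symm ha) k⟩
      · intro x
        rw [insZ_col_succ]
      · rw [w.2 _ _ ha]
        rfl
    · refine ⟨⟨z, Sum.inr (w.1.2 0)⟩, ?_⟩
      apply BZ.ext_succ
      · intro x y
        rw [insZ_rel_succ]
        rfl
      · intro x
        exact ⟨fun k => absurd k (insZ_rel_zero_inr _ _ _), fun k => absurd ⟨x, k⟩ hex⟩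
      · intro x
        rw [insZ_col_succ]
      · rw [insZ_col_zero_inr]

theorem card_option_col {Q : Type} [Finite Q] (c : Q → Bool) (b b' : Bool) :
    Nat.card {o : Option Q // o.elim b c = b'} =
      Nat.card {q // c q = b'} + if b = b' then 1 else 0 := by
  classical
  have := Fintype.ofFinite Q
  simp only [Nat.card_eq_fintype_card, Fintype.card_subtype]
  have : (Finset.univ.filter fun o : Option Q => o.elim b c = b') =
      (Finset.univ.filter fun q => c q = b').map Function.Embedding.some ∪
        (if b = b' then {none} else ∅) := by
    ext o
    cases o <;> split_ifs <;> simp_all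
  rw [this, Finset.card_union_of_disjoint]
  · split_ifs <;> simp
  · split_ifs <;> simp

theorem insZ_stat {n : ℕ} (y : Σ z : BZ (Fin n), Quotient z.1.1 ⊕ Bool) :
    (insZ y).stat = bump y.1.stat y.2 := by
  rcases y with ⟨z, q | b⟩
  · refine (mkZ_stat _ _ ?_).trans rfl
    intro q
    induction q using Quotient.inductionOn with
    | _ a => exact ⟨a.succ, by simp⟩
  · refine (mkZ_stat _ _ ?_).trans ?_
    · rintro (_ | q)
      · exact ⟨0, by simp⟩
      · induction q using Quotient.inductionOn with
        | _ a => exact ⟨a.succ, by simp⟩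
    · rw [card_option_col, card_option_col]
      cases b <;> simp [bump, BZ.stat]

theorem BZ.card_classes {α : Type} [Finite α] (z : BZ α) :
    Nat.card (Quotient z.1.1) = z.stat.1 + z.stat.2 := by
  classical
  have := Fintype.ofFinite (Quotient z.1.1)
  simp only [BZ.stat, Nat.card_eq_fintype_card, Fintype.card_subtype]
  rw [← Finset.card_univ, ← Finset.card_filter_add_card_filter_not (fun q => z.col q = true)]
  simp

theorem statEq_Z (n : ℕ) :
    StatEq (extS (BZ.stat (α := Fin n))) (BZ.stat (α := Fin (n + 1))) :=
  StatEq.of_ext _ _ (fun z => Quotient z.1.1) (fun _ => inferInstance)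
    (fun z => z.card_classes) insZ (insZ_bijective n) insZ_stat

/-- The target type. -/
abbrev Targ (n : ℕ) : Type := (Σ P : Finpartition (Finset.univ : Finset (Fin n)),
          ({b : Finset (Fin n) // b ∈ P.parts} → Bool))

/-- The class map of a partition. -/
def Targ.cl {n : ℕ} (P : Finpartition (Finset.univ : Finset (Fin n))) (a : Fin n) :
    {b : Finset (Fin n) // b ∈ P.parts} := ⟨P.part a, P.part_mem.2 (Finset.mem_univ a)⟩

theorem Targ.cl_surj {n : ℕ} (P : Finpartition (Finset.univ : Finset (Fin n))) :
    Function.Surjective (Targ.cl P) := by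
  rintro ⟨b, hb⟩
  obtain ⟨a, ha⟩ := P.nonempty_of_mem_parts hb
  exact ⟨a, Subtype.ext (P.part_eq_of_mem hb ha)⟩

/-- From bicolored partitions to bicolored equivalence relations. -/
def Targ.toZ {n : ℕ} (t : Targ n) : BZ (Fin n) := mkZ (Targ.cl t.1) t.2

theorem Targ.toZ_bijective (n : ℕ) : Function.Bijective (Targ.toZ (n := n)) := by
  classical
  constructor
  · rintro ⟨P, c⟩ ⟨Q, d⟩ h
    have hr : ∀ a b, P.part a = P.part b ↔ Q.part a = Q.part b := by
      intro a b
      have h1 : (Targ.toZ ⟨P, c⟩).1.1 a b ↔ (Targ.toZ ⟨Q, d⟩).1.1 a b := by rw [h]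
      rw [Targ.toZ, Targ.toZ, mkZ_rel, mkZ_rel] at h1
      simpa [Targ.cl] using h1
    have hp : ∀ a, P.part a = Q.part a := by
      intro a
      ext b
      rw [P.mem_part_iff_part_eq_part (Finset.mem_univ _) (Finset.mem_univ _),
        Q.mem_part_iff_part_eq_part (Finset.mem_univ _) (Finset.mem_univ _), hr]
    have hPQ : P = Q := by
      ext b
      constructor
      · intro hb
        obtain ⟨a, ha⟩ := Targ.cl_surj P ⟨b, hb⟩
        have : P.part a = b := congrArg Subtype.val ha
        rw [← this, hp]
        exact Q.part_mem.2 (Finset.mem_univ _)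
      · intro hb
        obtain ⟨a, ha⟩ := Targ.cl_surj Q ⟨b, hb⟩
        have : Q.part a = b := congrArg Subtype.val ha
        rw [← this, ← hp]
        exact P.part_mem.2 (Finset.mem_univ _)
    subst hPQ
    congr 1
    funext b
    obtain ⟨a, rfl⟩ := Targ.cl_surj P b
    exact congrFun (congrArg (fun z : BZ (Fin n) => z.1.2) h) a
  · intro z
    let P := Finpartition.ofSetoid z.1.1
    have hP : ∀ a b, P.part a = P.part b ↔ z.1.1 a b := by
      intro a b
      rw [← P.mem_part_iff_part_eq_part (Finset.mem_univ _) (Finset.mem_univ _),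
        Finpartition.mem_part_ofSetoid_iff_rel]
      exact ⟨fun h => z.1.1.symm h, fun h => z.1.1.symm h⟩
    choose g hg using Targ.cl_surj P
    refine ⟨⟨P, fun b => z.1.2 (g b)⟩, Subtype.ext (Prod.ext ?_ ?_)⟩
    · ext a b
      rw [← hP]
      refine (mkZ_rel _ _ _ _).trans ?_
      simp [Targ.cl]
    · funext a
      apply z.2
      rw [← hP]
      exact congrArg Subtype.val (hg (Targ.cl P a))

theorem Targ.toZ_stat {n : ℕ} (t : Targ n) : t.toZ.stat =
    ((Finset.univ.filter fun b => t.2 b = true).card,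
      (Finset.univ.filter fun b => t.2 b = false).card) := by
  refine (mkZ_stat _ _ (Targ.cl_surj t.1)).trans ?_
  simp only [Nat.card_eq_fintype_card, Fintype.card_subtype]

theorem IsPermOf.length {n : ℕ} {l : List ℕ} (h : IsPermOf n l) : l.length = n := by
  have := List.Perm.length_eq h
  simpa using this

theorem IsPermOf.pos {n : ℕ} {l : List ℕ} (h : IsPermOf n l) (i : ℕ) (hi : i < l.length) :
    1 ≤ l.getD i 0 := by
  rw [List.getD_eq_getElem _ _ hi]
  have h1 : l[i] ∈ l := List.getElem_mem hi
  have := (List.Perm.mem_iff h).1 h1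
  simp only [List.mem_map] at this
  obtain ⟨a, -, ha⟩ := this
  omega

theorem IsPermOf.inj {n : ℕ} {l : List ℕ} (h : IsPermOf n l) (i j : ℕ) (hi : i < l.length)
    (hj : j < l.length) (hij : l.getD i 0 = l.getD j 0) : i = j := by
  rw [List.getD_eq_getElem _ _ hi, List.getD_eq_getElem _ _ hj] at hij
  have hnd : l.Nodup := (List.Perm.nodup_iff h).2
    (List.Nodup.map (fun a b hab => by simpa using hab) List.nodup_range)
  exact (List.Nodup.getElem_inj_iff hnd).1 hij

/-- Left-to-right maximum position. -/
def LRm (l : List ℕ) (i : ℕ) : Prop := ∀ j < i, l.getD j 0 < l.getD i 0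

/-- Right-to-left maximum position. -/
def RLm (l : List ℕ) (i : ℕ) : Prop := ∀ j < l.length, i < j → l.getD j 0 < l.getD i 0

/-- Insert a new minimum at position `p`. -/
def insL (p : ℕ) (l : List ℕ) : List ℕ := (l.map (· + 1)).insertIdx p 1

theorem insL_length {p : ℕ} {l : List ℕ} (hp : p ≤ l.length) :
    (insL p l).length = l.length + 1 := by
  rw [insL, List.length_insertIdx_of_le_length (by simpa using hp)]
  simp

theorem insL_getD {p : ℕ} {l : List ℕ} (hp : p ≤ l.length) (i : ℕ) (hi : i < l.length + 1) :
    (insL p l).getD i 0 = if i < p then l.getD i 0 + 1 else if i = p then 1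
      else l.getD (i - 1) 0 + 1 := by
  have hi' : i < (insL p l).length := by rw [insL_length hp]; exact hi
  rw [List.getD_eq_getElem _ _ hi']
  simp only [insL]
  rw [List.getElem_insertIdx]
  split_ifs with h1 h2
  · rw [List.getD_eq_getElem _ _ (by omega)]
    simp
  · rfl
  · rw [List.getD_eq_getElem _ _ (by omega)]
    simp

theorem insL_isPermOf {p n : ℕ} {l : List ℕ} (hp : p ≤ l.length) :
    IsPermOf (n + 1) (insL p l) ↔ IsPermOf n l := by
  unfold IsPermOf insL
  have h1 : ((l.map (· + 1)).insertIdx p 1).Perm (1 :: l.map (· + 1)) :=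
    List.perm_insertIdx _ _ (by simpa using hp)
  have h2 : (List.range (n + 1)).map (· + 1) =
      1 :: ((List.range n).map (· + 1)).map (· + 1) := by
    rw [List.range_succ_eq_map]
    simp
  rw [h2, h1.congr_left, List.perm_cons]
  exact List.map_perm_map_iff (fun a b hab => by simpa using hab)

theorem insL_occ {p : ℕ} {l : List ℕ} (hp : p ≤ l.length)
    (hpos : ∀ i < l.length, 1 ≤ l.getD i 0)
    (hinj : ∀ i j, i < l.length → j < l.length → l.getD i 0 = l.getD j 0 → i = j) :
    Occ3123 (insL p l) ↔ Occ3123 l ∨ (p < l.length ∧ ¬ LRm l p ∧ ¬ RLm l p) := by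
  have hg := insL_getD hp
  have hlen := insL_length hp
  unfold Occ3123 LRm RLm
  rw [hlen]
  generalize (insL p l) = m at *
  obtain ⟨f, hf⟩ : ∃ f : ℕ → ℕ, ∀ i, l.getD i 0 = f i := ⟨_, fun _ => rfl⟩
  simp only [hf] at hg hpos hinj ⊢
  constructor
  · rintro ⟨i, j, k, hij, hjk, hk, h1, h2, h3⟩
    rw [hg j (by omega), hg (j + 1) (by omega)] at h1
    rw [hg i (by omega), hg (j + 1) (by omega)] at h2
    rw [hg k (by omega), hg (j + 1) (by omega)] at h3
    by_cases hjp : j = p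
    · right
      subst hjp
      refine ⟨by omega, ?_, ?_⟩
      · intro h
        have := h i hij
        simp [hij] at h2
        omega
      · intro h
        have := h (k - 1) (by omega) (by omega)
        have e1 : ¬ k < j := by omega
        have e2 : ¬ k = j := by omega
        simp [e1, e2] at h3
        omega
    · left
      by_cases hjp' : j + 1 = p
      · subst hjp'
        simp at h1
      · have hjp2 : ¬ (j = p) := hjp
        have hi : i ≠ p := by
          intro hh
          split_ifs at h2 <;> omega
        have hkp : k ≠ p := by
          intro hh
          split_ifs at h3 <;> omega
        refine ⟨if i < p then i else i - 1, if j < p then j else j - 1,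
          if k < p then k else k - 1, ?_, ?_, ?_, ?_⟩
        · split_ifs <;> omega
        · split_ifs <;> omega
        · split_ifs <;> omega
        · have e : (if j < p then j else j - 1) + 1 = if j + 1 < p then j + 1 else j := by
            split_ifs <;> omega
          rw [e]
          simp only [hi, hkp, hjp', hjp, if_false, add_tsub_cancel_right] at h1 h2 h3
          refine ⟨?_, ?_, ?_⟩
          · split_ifs at h1 ⊢ <;> omega
          · split_ifs at h2 ⊢ <;> omega
          · split_ifs at h3 ⊢ <;> omega
  · rintro (⟨i, j, k, hij, hjk, hk, h1, h2, h3⟩ | ⟨hpl, h1, h2⟩)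
    · by_cases hjp : j + 1 = p
      · -- the new minimum splits the ascent
        refine ⟨i, p, k + 1, by omega, by omega, by omega, ?_⟩
        rw [hg p (by omega), hg (p + 1) (by omega), hg i (by omega), hg (k + 1) (by omega)]
        have := hpos (j + 1) (by omega)
        subst hjp
        have e1 : i < j + 1 := by omega
        have e2 : ¬ k + 1 < j + 1 := by omega
        have e3 : ¬ k + 1 = j + 1 := by omega
        have e4 : k ≠ j := by omega
        simp [e1, e2, e4]
        omega
      · refine ⟨if i < p then i else i + 1, if j < p then j else j + 1,
          if k < p then k else k + 1, ?_, ?_, ?_, ?_⟩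
        · split_ifs <;> omega
        · split_ifs <;> omega
        · split_ifs <;> omega
        · have key : ∀ a, a < l.length →
              m.getD (if a < p then a else a + 1) 0 = f a + 1 := by
            intro a ha
            rw [hg _ (by split_ifs <;> omega)]
            split_ifs <;> first | omega | rfl | simp
          have e : (if j < p then j else j + 1) + 1 = if j + 1 < p then j + 1 else j + 1 + 1 := by
            split_ifs <;> omega
          rw [e, key j (by omega), key (j + 1) (by omega), key i (by omega), key k (by omega)]
          omega
    · push Not at h1 h2
      obtain ⟨i, hi, h1⟩ := h1
      obtain ⟨k, hk, hpk, h2⟩ := h2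
      have n1 : f i ≠ f p := fun h => by
        have := hinj _ _ (by omega) hpl h
        omega
      have n2 : f k ≠ f p := fun h => by
        have := hinj _ _ (by omega) hpl h
        omega
      have := hpos p hpl
      refine ⟨i, p, k + 1, by omega, by omega, by omega, ?_⟩
      rw [hg p (by omega), hg (p + 1) (by omega), hg i (by omega), hg (k + 1) (by omega)]
      rw [if_neg (by omega), if_pos rfl, if_neg (by omega), if_neg (by omega), if_pos hi,
        if_neg (by omega), if_neg (by omega), Nat.add_sub_cancel, Nat.add_sub_cancel]
      omega

/-- Shift of positions when inserting at position `p`. -/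
def shf (p i : ℕ) : ℕ := if i < p then i else i + 1

theorem shf_inj (p : ℕ) : Function.Injective (shf p) := by
  intro a b h
  unfold shf at h
  split_ifs at h <;> omega

theorem shf_lt (p a b : ℕ) : shf p a < shf p b ↔ a < b := by
  unfold shf
  split_ifs <;> omega

theorem shf_or (p i : ℕ) : i = p ∨ ∃ a, i = shf p a := by
  by_cases h : i = p
  · exact Or.inl h
  · right
    by_cases h' : i < p
    · exact ⟨i, by simp [shf, h']⟩
    · exact ⟨i - 1, by unfold shf; split_ifs <;> omega⟩

theorem insL_shf {p : ℕ} {l : List ℕ} (hp : p ≤ l.length) (a : ℕ) (ha : a < l.length) :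
    (insL p l).getD (shf p a) 0 = l.getD a 0 + 1 := by
  unfold shf
  rw [insL_getD hp _ (by split_ifs <;> omega)]
  split_ifs <;> first | omega | rfl | simp

theorem insL_self {p : ℕ} {l : List ℕ} (hp : p ≤ l.length) :
    (insL p l).getD p 0 = 1 := by
  rw [insL_getD hp _ (by omega)]
  simp

theorem insL_LRm_shf {p : ℕ} {l : List ℕ} (hp : p ≤ l.length)
    (hpos : ∀ i < l.length, 1 ≤ l.getD i 0) (a : ℕ) (ha : a < l.length) :
    LRm (insL p l) (shf p a) ↔ LRm l a := by
  unfold LRm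
  rw [insL_shf hp a ha]
  constructor
  · intro h j hj
    have := h (shf p j) ((shf_lt p j a).2 hj)
    rw [insL_shf hp j (by omega)] at this
    omega
  · intro h j hj
    rcases shf_or p j with rfl | ⟨b, rfl⟩
    · rw [insL_self hp]
      have := hpos a ha
      omega
    · rw [shf_lt] at hj
      rw [insL_shf hp b (by omega)]
      have := h b hj
      omega

theorem shf_lt_succ {p N a : ℕ} (hp : p ≤ N) : shf p a < N + 1 ↔ a < N := by
  unfold shf
  split_ifs <;> omega

theorem insL_RLm_shf {p : ℕ} {l : List ℕ} (hp : p ≤ l.length)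
    (hpos : ∀ i < l.length, 1 ≤ l.getD i 0) (a : ℕ) (ha : a < l.length) :
    RLm (insL p l) (shf p a) ↔ RLm l a := by
  unfold RLm
  rw [insL_shf hp a ha, insL_length hp]
  constructor
  · intro h j hjl hj
    have := h (shf p j) ((shf_lt_succ hp).2 hjl) ((shf_lt p a j).2 hj)
    rw [insL_shf hp j (by omega)] at this
    omega
  · intro h j hjl hj
    rcases shf_or p j with rfl | ⟨b, rfl⟩
    · rw [insL_self hp]
      have := hpos a ha
      omega
    · rw [shf_lt] at hj
      rw [shf_lt_succ hp] at hjl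
      rw [insL_shf hp b (by omega)]
      have := h b hjl hj
      omega

theorem insL_LRm_self {p : ℕ} {l : List ℕ} (hp : p ≤ l.length) :
    LRm (insL p l) p ↔ p = 0 := by
  unfold LRm
  rw [insL_self hp]
  constructor
  · intro h
    by_contra h0
    have := h 0 (by omega)
    rw [insL_getD hp _ (by omega), if_pos (by omega)] at this
    omega
  · rintro rfl j hj
    omega

theorem insL_RLm_self {p : ℕ} {l : List ℕ} (hp : p ≤ l.length) :
    RLm (insL p l) p ↔ p = l.length := by
  unfold RLm
  rw [insL_self hp, insL_length hp]
  constructor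
  · intro h
    by_contra h0
    have := h l.length (by omega) (by omega)
    rw [insL_getD hp _ (by omega), if_neg (by omega), if_neg (by omega)] at this
    omega
  · rintro rfl j hj hj'
    omega

theorem card_shf (p N : ℕ) (hp : p ≤ N) (A B : ℕ → Prop) (C : Prop) [DecidablePred A]
    [DecidablePred B] [Decidable C] (h : ∀ a < N, A (shf p a) ↔ B a) (h' : A p ↔ C) :
    ((Finset.range (N + 1)).filter A).card =
      ((Finset.range N).filter B).card + if C then 1 else 0 := by
  have : (Finset.range (N + 1)).filter A =
      ((Finset.range N).filter B).map ⟨shf p, shf_inj p⟩ ∪ (if C then {p} else ∅) := by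
    ext i
    have hne : ∀ a, shf p a ≠ p := by
      intro a
      unfold shf
      split_ifs <;> omega
    rcases shf_or p i with rfl | ⟨a, rfl⟩
    · by_cases hC : C
      · simp [h', hC]
        omega
      · simp [h', hC, hne]
    · simp only [Finset.mem_filter, Finset.mem_range, Finset.mem_union, Finset.mem_map,
        Function.Embedding.coeFn_mk]
      rw [shf_lt_succ hp]
      have e : shf p a ∉ (if C then {p} else ∅ : Finset ℕ) := by
        split_ifs <;> simp [hne]
      constructor
      · rintro ⟨h1, h2⟩
        exact Or.inl ⟨a, ⟨h1, (h a h1).1 h2⟩, rfl⟩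
      · rintro (⟨b, ⟨h1, h2⟩, h3⟩ | h1)
        · obtain rfl := shf_inj p h3
          exact ⟨h1, (h b h1).2 h2⟩
        · exact absurd h1 e
  rw [this, Finset.card_union_of_disjoint]
  · split_ifs <;> simp
  · rw [Finset.disjoint_left]
    intro x hx hx'
    split_ifs at hx'
    · simp only [Finset.mem_singleton] at hx'
      subst hx'
      simp only [Finset.mem_map, Function.Embedding.coeFn_mk] at hx
      obtain ⟨a, -, ha⟩ := hx
      unfold shf at ha
      split_ifs at ha <;> omega
    · simp at hx'

theorem insL_numLMAX {p : ℕ} {l : List ℕ} (hp : p ≤ l.length)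
    (hpos : ∀ i < l.length, 1 ≤ l.getD i 0) :
    numLMAX (insL p l) = numLMAX l + if p = 0 then 1 else 0 := by
  unfold numLMAX
  rw [insL_length hp]
  exact card_shf p l.length hp _ _ _ (insL_LRm_shf hp hpos) (insL_LRm_self hp)

theorem insL_numRMAX {p : ℕ} {l : List ℕ} (hp : p ≤ l.length)
    (hpos : ∀ i < l.length, 1 ≤ l.getD i 0) :
    numRMAX (insL p l) = numRMAX l + if p = l.length then 1 else 0 := by
  have h1 : ∀ m : List ℕ, ∀ i, (∀ j < m.length, i < j → m.getD j 0 < m.getD i 0) ↔ RLm m i :=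
    fun m i => Iff.rfl
  classical
  unfold numRMAX
  simp only [h1]
  rw [insL_length hp]
  exact card_shf p l.length hp _ _ _ (insL_RLm_shf hp hpos) (insL_RLm_self hp)

theorem exists_argmax (l : List ℕ) (hl : 0 < l.length) :
    ∃ m < l.length, ∀ i < l.length, l.getD i 0 ≤ l.getD m 0 := by
  obtain ⟨m, hm, h⟩ := Finset.exists_max_image (Finset.range l.length) (fun i => l.getD i 0)
    ⟨0, by simpa using hl⟩
  exact ⟨m, by simpa using hm, fun i hi => h i (by simpa using hi)⟩

theorem card_choices {l : List ℕ} (hl : 0 < l.length)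
    (hinj : ∀ i j, i < l.length → j < l.length → l.getD i 0 = l.getD j 0 → i = j) :
    1 ≤ numLMAX l ∧ 1 ≤ numRMAX l ∧
    Nat.card {p // 0 < p ∧ p < l.length ∧ (LRm l p ∨ RLm l p)} =
      (numLMAX l - 1) + (numRMAX l - 1) := by
  classical
  obtain ⟨m, hm, hmax⟩ := exists_argmax l hl
  have hmax' : ∀ i < l.length, i ≠ m → l.getD i 0 < l.getD m 0 := fun i hi hne =>
    lt_of_le_of_ne (hmax i hi) fun h => hne (hinj _ _ hi hm h)
  let A := (Finset.range l.length).filter (LRm l)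
  let B := (Finset.range l.length).filter (RLm l)
  have hA : numLMAX l = A.card := by
    unfold numLMAX
    congr 1
    ext i
    simp [A, LRm]
  have hB : numRMAX l = B.card := by
    unfold numRMAX
    congr 1
    ext i
    simp [B, RLm]
  have hAB : A ∩ B = {m} := by
    ext i
    simp only [A, B, Finset.mem_inter, Finset.mem_filter, Finset.mem_range,
      Finset.mem_singleton]
    constructor
    · rintro ⟨⟨hi, h1⟩, ⟨-, h2⟩⟩
      by_contra hne
      have h3 := hmax' i hi hne
      rcases lt_or_gt_of_ne hne with h | h
      · have := h2 m hm h
        omega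
      · have := h1 m h
        omega
    · rintro rfl
      exact ⟨⟨hm, fun j hj => hmax' j (by omega) (by omega)⟩,
        ⟨hm, fun j hj hj' => hmax' j (by omega) (by omega)⟩⟩
  have h0 : 0 ∈ A ∪ B := by
    apply Finset.mem_union_left
    simp only [A, Finset.mem_filter, Finset.mem_range]
    exact ⟨hl, fun j hj => by omega⟩
  have hmA : m ∈ A ∩ B := by rw [hAB]; simp
  rw [Finset.mem_inter] at hmA
  have h1 : 0 < A.card := Finset.card_pos.2 ⟨m, hmA.1⟩
  have h2 : 0 < B.card := Finset.card_pos.2 ⟨m, hmA.2⟩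
  refine ⟨by omega, by omega, ?_⟩
  have h3 : Nat.card {p // 0 < p ∧ p < l.length ∧ (LRm l p ∨ RLm l p)} =
      ((A ∪ B).erase 0).card := by
    refine Nat.subtype_card _ ?_
    intro x
    simp only [A, B, Finset.mem_erase, Finset.mem_union, Finset.mem_filter, Finset.mem_range]
    constructor
    · rintro ⟨h, h'⟩
      exact ⟨by omega, by tauto⟩
    · rintro ⟨h, h'⟩
      exact ⟨by omega, by tauto⟩
  rw [h3, Finset.card_erase_of_mem h0, hA, hB]
  have h4 := Finset.card_union_add_card_inter A B
  rw [hAB, Finset.card_singleton] at h4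
  omega

/-- Avoiders of length `n + 1`. -/
abbrev Av (n : ℕ) : Type := {l : List ℕ // IsPermOf (n + 1) l ∧ ¬ Occ3123 l}

/-- The statistic on avoiders. -/
def Av.stat {n : ℕ} (l : Av n) : ℕ × ℕ := (numLMAX l.1 - 1, numRMAX l.1 - 1)

/-- Neutral insertion positions. -/
abbrev Av.D {n : ℕ} (l : Av n) : Type :=
  {p // 0 < p ∧ p < l.1.length ∧ (LRm l.1 p ∨ RLm l.1 p)}

/-- Position of insertion. -/
def Av.ipos {n : ℕ} (l : Av n) : l.D ⊕ Bool → ℕ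
  | Sum.inl d => d.1
  | Sum.inr true => 0
  | Sum.inr false => l.1.length

theorem Av.length {n : ℕ} (l : Av n) : l.1.length = n + 1 := l.2.1.length

theorem Av.ipos_le {n : ℕ} (l : Av n) (o) : l.ipos o ≤ l.1.length := by
  rcases o with d | (_ | _)
  · exact d.2.2.1.le
  · exact le_rfl
  · exact Nat.zero_le _

theorem Av.ipos_inj {n : ℕ} (l : Av n) : Function.Injective l.ipos := by
  have hl := l.length
  rintro (d | (_ | _)) (d' | (_ | _)) h <;> simp only [Av.ipos] at h
  · rw [Subtype.ext h]
  · have := d.2.2.1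
    omega
  · have := d.2.1
    omega
  · have := d'.2.2.1
    omega
  · rfl
  · omega
  · have := d'.2.1
    omega
  · omega
  · rfl

theorem Av.ipos_good {n : ℕ} (l : Av n) (o) :
    ¬ (l.ipos o < l.1.length ∧ ¬ LRm l.1 (l.ipos o) ∧ ¬ RLm l.1 (l.ipos o)) := by
  rcases o with d | (_ | _)
  · have := d.2.2.2
    simp only [Av.ipos]
    tauto
  · simp [Av.ipos]
  · rintro ⟨-, h, -⟩
    exact h fun j hj => absurd hj (Nat.not_lt_zero _)

theorem Av.ipos_surj {n : ℕ} (l : Av n) (p : ℕ) (hp : p ≤ l.1.length)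
    (h : ¬ (p < l.1.length ∧ ¬ LRm l.1 p ∧ ¬ RLm l.1 p)) : ∃ o, l.ipos o = p := by
  by_cases h0 : p = 0
  · exact ⟨Sum.inr true, h0.symm⟩
  by_cases h1 : p = l.1.length
  · exact ⟨Sum.inr false, h1.symm⟩
  · exact ⟨Sum.inl ⟨p, by omega, by omega, by
      by_contra h2
      exact h ⟨by omega, by tauto⟩⟩, rfl⟩

/-- Insertion of a new minimum into an avoider. -/
def Av.ins {n : ℕ} (y : Σ l : Av n, l.D ⊕ Bool) : Av (n + 1) :=
  ⟨insL (y.1.ipos y.2) y.1.1, (insL_isPermOf (y.1.ipos_le _)).2 y.1.2.1, by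
    rw [insL_occ (y.1.ipos_le _) y.1.2.1.pos y.1.2.1.inj]
    rintro (h | h)
    · exact y.1.2.2 h
    · exact y.1.ipos_good _ h⟩

theorem insL_inj {p q : ℕ} {l m : List ℕ} (hp : p ≤ l.length) (hq : q ≤ m.length)
    (hpos : ∀ i < m.length, 1 ≤ m.getD i 0) (h : insL p l = insL q m) : p = q ∧ l = m := by
  have hlen : l.length = m.length := by
    have := congrArg List.length h
    rw [insL_length hp, insL_length hq] at this
    omega
  have hpq : p = q := by
    have h1 := insL_self hp
    rw [h] at h1
    rcases shf_or q p with h2 | ⟨a, rfl⟩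
    · exact h2
    · have ha : a < m.length := by
        rw [← shf_lt_succ hq]
        omega
      rw [insL_shf hq a ha] at h1
      have := hpos a ha
      omega
  subst hpq
  refine ⟨rfl, ?_⟩
  have h2 := congrArg (fun x => List.eraseIdx x p) h
  simp only [insL, List.eraseIdx_insertIdx_self] at h2
  exact List.map_injective_iff.2 (fun a b hab => by simpa using hab) h2

theorem insL_surj {n : ℕ} {m : List ℕ} (h : IsPermOf (n + 1) m) :
    ∃ p l, p ≤ l.length ∧ insL p l = m := by
  have h1 : 1 ∈ m := by
    rw [List.Perm.mem_iff h]
    simp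
  obtain ⟨p, hp, hpm⟩ := List.getElem_of_mem h1
  have hm : (m.eraseIdx p).insertIdx p 1 = m := by
    rw [← hpm]
    exact List.insertIdx_eraseIdx_getElem hp
  have hlen : p ≤ (m.eraseIdx p).length := by
    rw [List.length_eraseIdx_of_lt hp]
    omega
  have hperm : (m.eraseIdx p).Perm (((List.range n).map (· + 1)).map (· + 1)) := by
    have h2 : (List.range (n + 1)).map (· + 1) =
        1 :: ((List.range n).map (· + 1)).map (· + 1) := by
      rw [List.range_succ_eq_map]
      simp
    rw [← List.perm_cons 1, ← h2]
    refine List.Perm.trans ?_ h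
    conv_rhs => rw [← hm]
    exact (List.perm_insertIdx _ _ hlen).symm
  refine ⟨p, (m.eraseIdx p).map (· - 1), by simpa using hlen, ?_⟩
  unfold insL
  conv_rhs => rw [← hm]
  congr 1
  rw [List.map_map]
  conv_rhs => rw [← List.map_id (m.eraseIdx p)]
  apply List.map_congr_left
  intro a ha
  rw [hperm.mem_iff] at ha
  simp only [List.mem_map] at ha
  obtain ⟨b, -, hb⟩ := ha
  simp only [Function.comp, id]
  omega

theorem Av.ins_bijective (n : ℕ) : Function.Bijective (Av.ins (n := n)) := by
  constructor
  · rintro ⟨l, o⟩ ⟨m, u⟩ h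
    have h1 := congrArg Subtype.val h
    obtain ⟨h2, h3⟩ := insL_inj (l.ipos_le o) (m.ipos_le u) m.2.1.pos h1
    have : l = m := Subtype.ext h3
    subst this
    rw [l.ipos_inj h2]
  · rintro ⟨m, hm, hocc⟩
    obtain ⟨p, l, hp, rfl⟩ := insL_surj hm
    rw [insL_isPermOf hp] at hm
    rw [insL_occ hp hm.pos hm.inj, not_or] at hocc
    let x : Av n := ⟨l, hm, hocc.1⟩
    obtain ⟨o, ho⟩ := x.ipos_surj p hp hocc.2
    refine ⟨⟨x, o⟩, Subtype.ext ?_⟩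
    simp only [Av.ins, ho]
    rfl

theorem Av.choices {n : ℕ} (l : Av n) :
    1 ≤ numLMAX l.1 ∧ 1 ≤ numRMAX l.1 ∧
    Nat.card l.D = (numLMAX l.1 - 1) + (numRMAX l.1 - 1) :=
  card_choices (l := l.1) (by rw [l.length]; omega) l.2.1.inj

theorem Av.ins_stat {n : ℕ} (y : Σ l : Av n, l.D ⊕ Bool) :
    (Av.ins y).stat = bump y.1.stat y.2 := by
  obtain ⟨l, o⟩ := y
  have hl := l.length
  obtain ⟨c1, c2, -⟩ := l.choices
  simp only [Av.stat, Av.ins]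
  rw [insL_numLMAX (l.ipos_le _) l.2.1.pos, insL_numRMAX (l.ipos_le _) l.2.1.pos]
  have hpl : ∀ o, l.ipos o = (match o with
    | Sum.inl d => d.1
    | Sum.inr true => 0
    | Sum.inr false => l.1.length) := fun o => by rcases o with d | (_ | _) <;> rfl
  rw [hpl]
  rcases o with d | (_ | _)
  · have h1 := d.2.1
    have h2 := d.2.2.1
    have e1 : d.1 ≠ 0 := by omega
    have e2 : d.1 ≠ l.1.length := by omega
    simp [bump, e1, e2]
  · have e1 : l.1.length ≠ 0 := by omega
    ext
    · simp [bump, hl]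
    · simp [bump]
      omega
  · have e1 : 0 ≠ l.1.length := by omega
    ext
    · simp [bump]
      omega
    · simp [bump, hl]

theorem statEq_Av (n : ℕ) :
    StatEq (extS (Av.stat (n := n))) (Av.stat (n := n + 1)) :=
  StatEq.of_ext _ _ Av.D
    (fun l => Set.Finite.to_subtype
      ((Set.finite_lt_nat l.1.length).subset fun _ h => h.2.1))
    (fun l => l.choices.2.2) Av.ins (Av.ins_bijective n) Av.ins_stat

theorem Av.zero (l : Av 0) : l.1 = [1] := by
  have := l.2.1
  simpa [IsPermOf] using this

theorem statEq_zero : StatEq (Av.stat (n := 0)) (BZ.stat (α := Fin 0)) := by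
  have h1 : Unique (Av 0) :=
    { default := ⟨[1], by simp [IsPermOf], by
        rintro ⟨i, j, k, h1, h2, h3, -⟩
        simp at h3
        omega⟩
      uniq := fun a => Subtype.ext (Av.zero a) }
  have h2 : Unique (BZ (Fin 0)) :=
    { default := ⟨(⊥, fun _ => true), fun _ _ _ => rfl⟩
      uniq := fun a => Subtype.ext (Prod.ext (Setoid.ext fun x => x.elim0)
        (funext fun x => x.elim0)) }
  refine ⟨Equiv.ofUnique _ _, fun l => ?_⟩
  have hz : ∀ z : BZ (Fin 0), z.stat = (0, 0) := by
    intro z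
    have : IsEmpty (Quotient z.1.1) := ⟨fun q => Quotient.inductionOn q fun a => a.elim0⟩
    simp [BZ.stat]
  rw [hz, Av.stat, Av.zero l]
  rfl

theorem statEq_main (n : ℕ) : StatEq (Av.stat (n := n)) (BZ.stat (α := Fin n)) := by
  induction n with
  | zero => exact statEq_zero
  | succ n ih => exact ((statEq_Av n).symm.trans ih.ext).trans (statEq_Z n)

/-- Permutations of length `n+1` avoiding `3-12-3` are in bijection with bicolored
set partitions of `{1,…,n}` (each block colored `true` or `false`), the number of
`true`-colored blocks being `#LMAX - 1` and the number of `false`-colored blocks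
being `#RMAX - 1`. -/
theorem avoid_3123_bij_bicolored_partitions (n : ℕ) :
    ∃ e : {l : List ℕ // IsPermOf (n + 1) l ∧ ¬ Occ3123 l} ≃
        (Σ P : Finpartition (Finset.univ : Finset (Fin n)),
          ({b : Finset (Fin n) // b ∈ P.parts} → Bool)),
      ∀ l, ((Finset.univ.filter fun b => (e l).2 b = true).card = numLMAX l.1 - 1 ∧
            (Finset.univ.filter fun b => (e l).2 b = false).card = numRMAX l.1 - 1) := by
  obtain ⟨e, he⟩ := statEq_main n
  refine ⟨e.trans (Equiv.ofBijective Targ.toZ (Targ.toZ_bijective n)).symm, fun l => ?_⟩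
  have h := Targ.toZ_stat ((e.trans (Equiv.ofBijective Targ.toZ (Targ.toZ_bijective n)).symm) l)
  have h2 : Targ.toZ ((e.trans (Equiv.ofBijective Targ.toZ (Targ.toZ_bijective n)).symm) l)
      = e l := (Equiv.ofBijective Targ.toZ (Targ.toZ_bijective n)).apply_symm_apply (e l)
  rw [h2, he] at h
  exact ⟨(congrArg Prod.fst h).symm, (congrArg Prod.snd h).symm⟩
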